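/- arXiv:1906.09073 — 2 statements merged into one kernel-verified Lean document; each statement's English description precedes it below -/
import Mathlib

section
/- Let G be a dynamic graph over a finite nonempty set V with a self-loop at every node in every round, with start rounds s_u, input values μ_u in a linearly ordered set 𝒱, cut-off values θ_u(t) with 0 ≤ θ_u(t) ≤ t, and MinMax outputs y_u(t). Assume the cut-offs are safe. If the outputs stabilize to a common value, i.e., there exist ỹ ∈ 𝒱 and a round s such that y_u(t) = ỹ for every node u and every t ≥ s, then ỹ = m*. -/
open scoped Classical

section DynamicGraphs

variable {V : Type*}

/-- The product digraph `G(t:t')`: edge `(u,v)` iff there is a path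
`w_t = u, …, w_{t'+1} = v` with `(w_k, w_{k+1})` an edge of `G(k)` for `t ≤ k ≤ t'`.
For `t' < t` it is the digraph with exactly a self-loop at each node. -/
def DProd (G : ℕ → V → V → Prop) (t t' : ℕ) (u v : V) : Prop :=
  if t' < t then u = v
  else ∃ w : ℕ → V, w t = u ∧ w (t' + 1) = v ∧ ∀ k, t ≤ k → k ≤ t' → G k (w k) (w (k + 1))

/-- The integral `Ḡ`: `(u,v)` is an edge of `Ḡ(t)` iff it is an edge of `G(t:t')`
for some `t' ≥ t`. -/
def Integral (G : ℕ → V → V → Prop) (t : ℕ) (u v : V) : Prop :=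
  ∃ t', t ≤ t' ∧ DProd G t t' u v

/-- The limit superior of a dynamic graph: edges occurring at infinitely many rounds. -/
def LimSupG (H : ℕ → V → V → Prop) (u v : V) : Prop :=
  ∀ t : ℕ, ∃ t', t ≤ t' ∧ H t' u v

/-- `u` is a central root of the digraph `H`: `(u,v)` is an edge for every `v`. -/
def IsCRoot (H : V → V → Prop) (u : V) : Prop := ∀ v, H u v

/-- `u` is a root of the digraph `H`: every node is reachable from `u` by a path. -/
def IsRoot (H : V → V → Prop) (u : V) : Prop := ∀ v, Relation.ReflTransGen H u v

/-- The kernel of a dynamic graph: `Ker(G) = ∩_{t ≥ 1} CRoots(Ḡ(t))`. -/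
def Ker (G : ℕ → V → V → Prop) : Set V :=
  {u | ∀ t, 1 ≤ t → IsCRoot (Integral G t) u}

/-- `G` is rooted with delay `T`: for every `t ≥ 1` the digraph `G(t : t+T-1)` is rooted. -/
def RootedWithDelay (G : ℕ → V → V → Prop) (T : ℕ) : Prop :=
  ∀ t, 1 ≤ t → ∃ u, IsRoot (fun a b => DProd G t (t + T - 1) a b) u

/-- The active graph `G^a` for start rounds `s`: `(u,v)` is an edge iff `u = v`, or
`(u,v)` is an edge of `G(t)` and both `u` and `v` are active in round `t`. -/
def Ga (G : ℕ → V → V → Prop) (s : V → ℕ) (t : ℕ) (u v : V) : Prop :=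
  u = v ∨ (G t u v ∧ s u ≤ t ∧ s v ≤ t)

lemma dprod_refl (H : ℕ → V → V → Prop) (hH : ∀ t u, H t u u) (t t' : ℕ) (u : V) :
    DProd H t t' u u := by
  unfold DProd
  split
  · rfl
  · exact ⟨fun _ => u, rfl, rfl, fun k _ _ => hH k u⟩

lemma ga_refl (G : ℕ → V → V → Prop) (s : V → ℕ) : ∀ (t : ℕ) (u : V), Ga G s t u u :=
  fun _ u => Or.inl rfl

end DynamicGraphs

section Values

variable {V 𝒱 : Type*} [Fintype V] [LinearOrder 𝒱]

/-- `m_u(t) = min{μ_v : v ∈ In^a_u(1:t)}`. -/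
noncomputable def mVal (G : ℕ → V → V → Prop) (s : V → ℕ) (μ : V → 𝒱) (u : V) (t : ℕ) : 𝒱 :=
  (Finset.univ.filter fun v => DProd (Ga G s) 1 t v u).inf'
    ⟨u, Finset.mem_filter.mpr ⟨Finset.mem_univ u, dprod_refl (Ga G s) (ga_refl G s) 1 t u⟩⟩ μ

/-- `m*_u = min{μ_v : v ∈ In^a_u(1:∞)}`. -/
noncomputable def mStar (G : ℕ → V → V → Prop) (s : V → ℕ) (μ : V → 𝒱) (u : V) : 𝒱 :=
  (Finset.univ.filter fun v => ∃ t', 1 ≤ t' ∧ DProd (Ga G s) 1 t' v u).inf'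
    ⟨u, Finset.mem_filter.mpr ⟨Finset.mem_univ u,
      ⟨1, le_refl 1, dprod_refl (Ga G s) (ga_refl G s) 1 1 u⟩⟩⟩ μ

/-- `m* = max{m*_u : u ∈ V}`. -/
noncomputable def mStarMax [Nonempty V] (G : ℕ → V → V → Prop) (s : V → ℕ) (μ : V → 𝒱) : 𝒱 :=
  Finset.univ.sup' Finset.univ_nonempty (mStar G s μ)

/-- The MinMax output `y_u(t) = max{ m_v(θ_u(t)) : v ∈ In^a_u(θ_u(t)+1 : t) }`. -/
noncomputable def yVal (G : ℕ → V → V → Prop) (s : V → ℕ) (μ : V → 𝒱) (θ : V → ℕ → ℕ)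
    (u : V) (t : ℕ) : 𝒱 :=
  (Finset.univ.filter fun v => DProd (Ga G s) (θ u t + 1) t v u).sup'
    ⟨u, Finset.mem_filter.mpr
      ⟨Finset.mem_univ u, dprod_refl (Ga G s) (ga_refl G s) (θ u t + 1) t u⟩⟩
    (fun v => mVal G s μ v (θ u t))

/-- The cut-offs are safe: `θ_u(t) → ∞` and `t - θ_u(t) → ∞`. -/
def SafeCutoffs (θ : V → ℕ → ℕ) : Prop :=
  ∀ u : V, Filter.Tendsto (fun t => θ u t) Filter.atTop Filter.atTop ∧
    Filter.Tendsto (fun t => t - θ u t) Filter.atTop Filter.atTop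

end Values

lemma DProd.mono_right {V : Type*} {H : ℕ → V → V → Prop} (hH : ∀ t u, H t u u)
    {a t t' : ℕ} {u v : V} (ha : a ≤ t) (htt' : t ≤ t') (h : DProd H a t u v) :
    DProd H a t' u v := by
  unfold DProd at h ⊢
  rw [if_neg (by omega)] at h ⊢
  obtain ⟨w, hu, hv, hw⟩ := h
  refine ⟨fun k => w (min k (t + 1)), ?_, ?_, fun k hak _ => ?_⟩
  · simpa [show min a (t + 1) = a by omega] using hu
  · simpa [show min (t' + 1) (t + 1) = t + 1 by omega] using hv
  · rcases le_or_gt k t with hk | hk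
    · simpa [show min k (t + 1) = k by omega, hk] using hw k hak hk
    · simpa [show min k (t + 1) = t + 1 by omega, show min k t = t by omega] using hH k (w (t + 1))

lemma eventually_mVal_eq_mStar {V 𝒱 : Type*} [Fintype V] [LinearOrder 𝒱]
    (G : ℕ → V → V → Prop) (s : V → ℕ) (μ : V → 𝒱) (u : V) :
    ∀ᶠ t in Filter.atTop, mVal G s μ u t = mStar G s μ u := by
  have key : ∀ᶠ t in Filter.atTop, ∀ v,
      (∃ t', 1 ≤ t' ∧ DProd (Ga G s) 1 t' v u) → DProd (Ga G s) 1 t v u := by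
    refine Filter.eventually_all.2 fun v => ?_
    by_cases h : ∃ t', 1 ≤ t' ∧ DProd (Ga G s) 1 t' v u
    · obtain ⟨t', h1, h2⟩ := h
      filter_upwards [Filter.eventually_ge_atTop t'] with t ht _
      exact h2.mono_right (ga_refl G s) h1 ht
    · exact Filter.Eventually.of_forall fun t h' => absurd h' h
  filter_upwards [key, Filter.eventually_ge_atTop 1] with t ht h1
  unfold mVal mStar
  congr 1
  ext v
  simp only [Finset.mem_filter, Finset.mem_univ, true_and]
  exact ⟨fun h => ⟨t, h1, h⟩, ht v⟩

/-- if the outputs of a safe MinMax algorithm stabilize to a common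
value `ỹ`, then `ỹ = m*`. -/
theorem safe_minmax_consensus_value_eq_mstar {V 𝒱 : Type*} [Fintype V] [Nonempty V]
    [LinearOrder 𝒱]
    (G : ℕ → V → V → Prop) (hloop : ∀ t u, G t u u)
    (s : V → ℕ) (hs : ∀ u, 1 ≤ s u) (μ : V → 𝒱)
    (θ : V → ℕ → ℕ) (hθ : ∀ (u : V) (t : ℕ), 1 ≤ t → θ u t ≤ t)
    (hsafe : SafeCutoffs θ)
    (ytil : 𝒱) (s0 : ℕ) (hstab : ∀ (u : V) (t : ℕ), s0 ≤ t → yVal G s μ θ u t = ytil) :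
    ytil = mStarMax G s μ := by
  have hy : ∀ u, ∀ᶠ t in Filter.atTop,
      yVal G s μ θ u t = ytil ∧ ∀ v, mVal G s μ v (θ u t) = mStar G s μ v := fun u =>
    ((Filter.eventually_ge_atTop s0).mono fun t ht => hstab u t ht).and <|
      (hsafe u).1.eventually <| Filter.eventually_all.2 fun v => eventually_mVal_eq_mStar G s μ v
  apply le_antisymm
  · obtain ⟨t, ht, hm⟩ := (hy (Classical.arbitrary V)).exists
    rw [← ht]
    refine Finset.sup'_le _ _ fun v _ => ?_
    rw [hm v]
    exact Finset.le_sup' (mStar G s μ) (Finset.mem_univ v)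
  · refine Finset.sup'_le _ _ fun u _ => ?_
    obtain ⟨t, ht, hm⟩ := (hy u).exists
    rw [← ht, ← hm u, yVal]
    refine Finset.le_sup' (fun v => mVal G s μ v (θ u t)) ?_
    simpa using dprod_refl (Ga G s) (ga_refl G s) (θ u t + 1) t u
end

section
/- Let G be a dynamic graph over a finite nonempty set V with a self-loop at every node in every round, with start rounds s_u and input values μ_u in a finite linearly ordered set 𝒱, and let x_u(t) and AGE_u(t) be defined by the AGE recursion. Let u be a node active at round t (t ≥ s_u), let δ be an integer with 0 ≤ δ ≤ t, and set θ = t − δ. Then max{ν ∈ 𝒱 : AGE_u(t)[ν] ≤ δ} = max{ min{μ_w : w ∈ In^a_v(1:θ)} : v ∈ In^a_u(θ+1 : t) }; that is, the output computed from the AGE vectors equals the MinMax value with cut-off θ = t − δ. -/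
open scoped Classical

section Age

variable {V 𝒱 : Type*} [Fintype V] [Fintype 𝒱] [LinearOrder 𝒱]

/-- The AGE recursion, computing for each round `t` and node `u` the pair
`(x_u(t), AGE_u(t))`. -/
noncomputable def AgeX (G : ℕ → V → V → Prop) (s : V → ℕ) (μ : V → 𝒱) :
    ℕ → V → 𝒱 × (𝒱 → ℕ∞)
  | 0 => fun u => (μ u, fun ν => if ν = μ u then 0 else ⊤)
  | t + 1 => fun u =>
      if s u ≤ t + 1 then
        let A : 𝒱 → ℕ∞ := fun ν =>
          1 + (Finset.univ.filter fun v => Ga G s (t + 1) v u).inf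
            (fun v => (AgeX G s μ t v).2 ν)
        let x : 𝒱 :=
          if h : (Finset.univ.filter fun ν => A ν < ⊤).Nonempty then
            (Finset.univ.filter fun ν => A ν < ⊤).min' h
          else μ u
        (x, fun ν => if ν = x then 0 else A ν)
      else (μ u, fun ν => if ν = μ u then 0 else ⊤)

end Age

section Products

variable {V : Type*}

lemma dprod_of_lt {H : ℕ → V → V → Prop} {a b : ℕ} (h : b < a) {v u : V} :
    DProd H a b v u ↔ v = u := by
  simp [DProd, h]

lemma dprod_succ {H : ℕ → V → V → Prop} {a t : ℕ} (h : a ≤ t + 1) {v u : V} :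
    DProd H a (t + 1) v u ↔ ∃ w, DProd H a t v w ∧ H (t + 1) w u := by
  constructor
  · intro hp
    rw [DProd, if_neg (by omega)] at hp
    obtain ⟨p, hpa, hpb, hp⟩ := hp
    refine ⟨p (t + 1), ?_, hpb ▸ hp (t + 1) h le_rfl⟩
    unfold DProd
    split_ifs with hlt
    · rw [← hpa, show a = t + 1 by omega]
    · exact ⟨p, hpa, rfl, fun k hk hk' => hp k hk (by omega)⟩
  · rintro ⟨w, hw, hwu⟩
    rw [DProd, if_neg (by omega)]
    unfold DProd at hw
    split_ifs at hw with hlt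
    · obtain rfl : a = t + 1 := by omega
      subst hw
      refine ⟨fun k => if k ≤ t + 1 then v else u, by simp, by simp, fun k hk hk' => ?_⟩
      obtain rfl : k = t + 1 := by omega
      simpa using hwu
    · obtain ⟨p, hpa, hpb, hp⟩ := hw
      refine ⟨fun k => if k ≤ t + 1 then p k else u, by simp [h, hpa], by simp,
        fun k hk hk' => ?_⟩
      rcases hk'.eq_or_lt with rfl | hlt'
      · simpa [hpb] using hwu
      · simpa [hk', show k ≤ t by omega] using hp k hk (by omega)

lemma dprod_trans {H : ℕ → V → V → Prop} {a b c : ℕ} (hab : a ≤ b + 1) (hbc : b ≤ c)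
    {v w u : V} (hvw : DProd H a b v w) (hwu : DProd H (b + 1) c w u) :
    DProd H a c v u := by
  induction c, hbc using Nat.le_induction generalizing u with
  | base =>
    rw [dprod_of_lt (by omega)] at hwu
    exact hwu ▸ hvw
  | succ c hc ih =>
    obtain ⟨z, hz, hzu⟩ := (dprod_succ (by omega)).1 hwu
    exact (dprod_succ (by omega)).2 ⟨z, ih hz, hzu⟩

lemma dprod_ga_of_lt_start {G : ℕ → V → V → Prop} {s : V → ℕ} {a t : ℕ} {v u : V}
    (ht : t < s u) (h : DProd (Ga G s) a t v u) : v = u := by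
  induction t with
  | zero =>
    unfold DProd at h
    split_ifs at h with h0
    · exact h
    · obtain ⟨p, rfl, rfl, hp⟩ := h
      obtain rfl : a = 0 := by omega
      rcases hp 0 le_rfl le_rfl with h | h
      · exact h
      · omega
  | succ t ih =>
    by_cases hat : a ≤ t + 1
    · obtain ⟨w, hw, hwu⟩ := (dprod_succ hat).1 h
      rcases hwu with rfl | hwu
      · exact ih (by omega) hw
      · omega
    · exact (dprod_of_lt (by omega)).1 h

end Products

section MinValues

variable {V 𝒱 : Type*} [Fintype V] [LinearOrder 𝒱]
  {G : ℕ → V → V → Prop} {s : V → ℕ} {μ : V → 𝒱}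

lemma mVal_le {t : ℕ} {v u : V} (h : DProd (Ga G s) 1 t v u) : mVal G s μ u t ≤ μ v :=
  Finset.inf'_le _ (by simpa using h)

lemma exists_mVal_eq (u : V) (t : ℕ) :
    ∃ v, DProd (Ga G s) 1 t v u ∧ mVal G s μ u t = μ v := by
  obtain ⟨v, hv, h⟩ := Finset.exists_mem_eq_inf' (f := μ)
    (s := Finset.univ.filter fun v => DProd (Ga G s) 1 t v u)
    ⟨u, Finset.mem_filter.mpr ⟨Finset.mem_univ u, dprod_refl (Ga G s) (ga_refl G s) 1 t u⟩⟩
  exact ⟨v, by simpa using hv, h⟩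

lemma mVal_le_mVal_of_dprod {r t : ℕ} (hrt : r ≤ t) {v u : V}
    (h : DProd (Ga G s) (r + 1) t v u) : mVal G s μ u t ≤ mVal G s μ v r := by
  obtain ⟨w, hw, heq⟩ := exists_mVal_eq (G := G) (s := s) (μ := μ) v r
  exact heq ▸ mVal_le (dprod_trans (by omega) hrt hw h)

lemma mVal_of_lt_start {t : ℕ} {u : V} (h : t < s u) : mVal G s μ u t = μ u := by
  obtain ⟨v, hv, heq⟩ := exists_mVal_eq (G := G) (s := s) (μ := μ) u t
  rw [heq, dprod_ga_of_lt_start h hv]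

lemma exists_mVal_succ_eq (u : V) (t : ℕ) :
    ∃ v, Ga G s (t + 1) v u ∧ mVal G s μ v t = mVal G s μ u (t + 1) := by
  obtain ⟨w, hw, heq⟩ := exists_mVal_eq (G := G) (s := s) (μ := μ) u (t + 1)
  obtain ⟨v, hwv, hvu⟩ := (dprod_succ (by omega)).1 hw
  refine ⟨v, hvu, le_antisymm (heq ▸ mVal_le hwv) (mVal_le_mVal_of_dprod (by omega) ?_)⟩
  exact (dprod_succ le_rfl).2 ⟨v, dprod_refl _ (ga_refl G s) _ _ _, hvu⟩

end MinValues

section AgeVectors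

variable {V 𝒱 : Type*} [Fintype V] [Fintype 𝒱] [LinearOrder 𝒱]

/-- The vector `A` of the AGE recursion in round `t + 1`. -/
noncomputable def ageUpdate (G : ℕ → V → V → Prop) (s : V → ℕ) (μ : V → 𝒱) (t : ℕ) (u : V)
    (ν : 𝒱) : ℕ∞ :=
  1 + (Finset.univ.filter fun v => Ga G s (t + 1) v u).inf (fun v => (AgeX G s μ t v).2 ν)

variable {G : ℕ → V → V → Prop} {s : V → ℕ} {μ : V → 𝒱}

lemma ageUpdate_le_iff {t : ℕ} {u : V} {ν : 𝒱} {d : ℕ} :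
    ageUpdate G s μ t u ν ≤ d ↔
      ∃ e : ℕ, d = e + 1 ∧ ∃ v, Ga G s (t + 1) v u ∧ (AgeX G s μ t v).2 ν ≤ e := by
  unfold ageUpdate
  cases d with
  | zero => simp
  | succ e =>
    rw [Nat.cast_succ, add_comm, ENat.add_le_add_iff_right ENat.one_ne_top,
      Finset.inf_le_iff (ENat.natCast_lt_top e)]
    simp

lemma ageX_of_lt_start {t : ℕ} {u : V} (h : t < s u) :
    AgeX G s μ t u = (μ u, fun ν => if ν = μ u then 0 else ⊤) := by
  cases t with
  | zero => rfl
  | succ t => simp [AgeX, not_le.2 h]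

lemma ageX_succ_of_isLeast {t : ℕ} {u : V} (h : s u ≤ t + 1) {x : 𝒱}
    (hx : IsLeast {ν | ageUpdate G s μ t u ν < ⊤} x) :
    AgeX G s μ (t + 1) u = (x, fun ν => if ν = x then 0 else ageUpdate G s μ t u ν) := by
  have hne : (Finset.univ.filter fun ν => ageUpdate G s μ t u ν < ⊤).Nonempty :=
    ⟨x, by simpa using hx.1⟩
  have hmin : (Finset.univ.filter fun ν => ageUpdate G s μ t u ν < ⊤).min' hne = x :=
    (Finset.isLeast_min' _ hne).unique (by simpa using hx)
  unfold ageUpdate at hne hmin ⊢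
  simp only [AgeX, if_pos h, dif_pos hne, hmin]

lemma ageX_snd_le_iff_of_lt_start {t : ℕ} {u : V} (h : t < s u)
    {ν : 𝒱} {d : ℕ} :
    (AgeX G s μ t u).2 ν ≤ d ↔
      ∃ r ≤ t, t ≤ r + d ∧ ∃ v, DProd (Ga G s) (r + 1) t v u ∧ mVal G s μ v r = ν := by
  rw [ageX_of_lt_start h]
  constructor
  · intro hν
    have hν : ν = μ u := by
      by_contra hne
      simp [hne] at hν
    exact ⟨t, le_rfl, by omega, u, dprod_refl _ (ga_refl G s) _ _ _,
      hν ▸ mVal_of_lt_start h⟩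
  · rintro ⟨r, hr, -, v, hv, rfl⟩
    obtain rfl := dprod_ga_of_lt_start h hv
    simp [mVal_of_lt_start (G := G) (μ := μ) (hr.trans_lt h)]

lemma ageX_snd_le_iff (hs : ∀ u, 1 ≤ s u) (t : ℕ) (u : V) (ν : 𝒱) (d : ℕ) :
    (AgeX G s μ t u).2 ν ≤ d ↔
      ∃ r ≤ t, t ≤ r + d ∧ ∃ v, DProd (Ga G s) (r + 1) t v u ∧ mVal G s μ v r = ν := by
  induction t generalizing u ν d with
  | zero => exact ageX_snd_le_iff_of_lt_start (hs u)
  | succ t ih =>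
    by_cases hu : s u ≤ t + 1
    swap
    · exact ageX_snd_le_iff_of_lt_start (not_le.1 hu)
    have hA : ∀ ν (d : ℕ), ageUpdate G s μ t u ν ≤ d ↔ ∃ r ≤ t, t + 1 ≤ r + d ∧
        ∃ v, DProd (Ga G s) (r + 1) (t + 1) v u ∧ mVal G s μ v r = ν := by
      intro ν d
      rw [ageUpdate_le_iff]
      constructor
      · rintro ⟨e, rfl, w, hwu, hw⟩
        obtain ⟨r, hr, hre, v, hv, hm⟩ := (ih w ν e).1 hw
        exact ⟨r, hr, by omega, v, (dprod_succ (by omega)).2 ⟨w, hv, hwu⟩, hm⟩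
      · rintro ⟨r, hr, hrd, v, hv, hm⟩
        obtain ⟨w, hvw, hwu⟩ := (dprod_succ (by omega)).1 hv
        exact ⟨d - 1, by omega, w, hwu, (ih w ν _).2 ⟨r, hr, by omega, v, hvw, hm⟩⟩
    have hleast : IsLeast {ν | ageUpdate G s μ t u ν < ⊤} (mVal G s μ u (t + 1)) := by
      constructor
      · obtain ⟨v, hv, hm⟩ := exists_mVal_succ_eq (G := G) (s := s) (μ := μ) u t
        refine ((hA _ 1).2 ⟨t, le_rfl, le_rfl, v, ?_, hm⟩).trans_lt (ENat.natCast_lt_top 1)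
        exact (dprod_succ le_rfl).2 ⟨v, dprod_refl _ (ga_refl G s) _ _ _, hv⟩
      · intro ν hν
        obtain ⟨n, hn⟩ := ENat.ne_top_iff_exists.1 (ne_of_lt hν)
        obtain ⟨r, hr, -, v, hv, rfl⟩ := (hA ν n).1 hn.ge
        exact mVal_le_mVal_of_dprod (by omega) hv
    rw [ageX_succ_of_isLeast hu hleast]
    by_cases hν : ν = mVal G s μ u (t + 1)
    · simp only [if_pos hν, zero_le, true_iff]
      exact ⟨t + 1, le_rfl, by omega, u, dprod_refl _ (ga_refl G s) _ _ _, hν.symm⟩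
    · simp only [if_neg hν, hA]
      constructor
      · rintro ⟨r, hr, h⟩
        exact ⟨r, by omega, h⟩
      · rintro ⟨r, hr, hrd, v, hv, hm⟩
        refine ⟨r, ?_, hrd, v, hv, hm⟩
        by_contra hlt
        obtain rfl : r = t + 1 := by omega
        rw [dprod_of_lt (by omega)] at hv
        exact hν (hv ▸ hm.symm)

end AgeVectors

/-- for an active node `u` at round `t` and `0 ≤ δ ≤ t` with `θ = t − δ`,
the output computed from the AGE vector, `max{ν : AGE_u(t)[ν] ≤ δ}`, equals the MinMax
value `max{ min{μ_w : w ∈ In^a_v(1:θ)} : v ∈ In^a_u(θ+1:t) }`. -/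
theorem age_output_eq_minmax {V 𝒱 : Type*} [Fintype V] [Nonempty V] [Fintype 𝒱]
    [LinearOrder 𝒱]
    (G : ℕ → V → V → Prop) (hloop : ∀ t u, G t u u)
    (s : V → ℕ) (hs : ∀ u, 1 ≤ s u) (μ : V → 𝒱)
    (u : V) (t : ℕ) (hu : s u ≤ t) (δ : ℕ) (hδ : δ ≤ t) :
    (Finset.univ.filter fun ν : 𝒱 => (AgeX G s μ t u).2 ν ≤ (δ : ℕ∞)).max =
      (((Finset.univ.filter fun v : V => DProd (Ga G s) (t - δ + 1) t v u).sup'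
        ⟨u, Finset.mem_filter.mpr
          ⟨Finset.mem_univ u, dprod_refl (Ga G s) (ga_refl G s) (t - δ + 1) t u⟩⟩
        (fun v => mVal G s μ v (t - δ)) : 𝒱) : WithBot 𝒱) := by
  have hne : (Finset.univ.filter fun v : V => DProd (Ga G s) (t - δ + 1) t v u).Nonempty :=
    ⟨u, by simpa using dprod_refl (Ga G s) (ga_refl G s) (t - δ + 1) t u⟩
  apply le_antisymm
  · refine Finset.max_le fun ν hν => WithBot.coe_le_coe.2 ?_
    obtain ⟨r, hr, hrd, v, hv, rfl⟩ :=
      (ageX_snd_le_iff hs t u ν δ).1 (Finset.mem_filter.1 hν).2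
    have hvv : DProd (Ga G s) (t - δ + 1) r v v := dprod_refl _ (ga_refl G s) _ _ _
    refine (mVal_le_mVal_of_dprod (by omega) hvv).trans ?_
    have hvu : DProd (Ga G s) (t - δ + 1) t v u := dprod_trans (by omega) hr hvv hv
    exact Finset.le_sup' (fun v => mVal G s μ v (t - δ))
      (Finset.mem_filter.2 ⟨Finset.mem_univ v, hvu⟩)
  · obtain ⟨v, hv, heq⟩ := Finset.exists_mem_eq_sup' hne (fun v => mVal G s μ v (t - δ))
    rw [heq]
    refine Finset.le_max (Finset.mem_filter.2 ⟨Finset.mem_univ _, ?_⟩)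
    exact (ageX_snd_le_iff hs t u _ δ).2
      ⟨t - δ, by omega, by omega, v, (Finset.mem_filter.1 hv).2, rfl⟩
end
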